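/- arXiv:1505.05574 — 2 statements merged into one kernel-verified Lean document; each statement's English description precedes it below -/
import Mathlib

section
/- Let A be a ring and Q a completely nilary (two-sided) ideal of A. Then for every positive integer n, the ideal Qⁿ is a completely nilary ideal of A. -/
/-!
Common definitions.

All rings are associative but not necessarily commutative and not necessarily unital,
so we work with `NonUnitalRing` and `TwoSidedIdeal`.

Since a non-unital ring has no `a ^ 0`, positive powers/products are indexed with a shift:
the index `n : ℕ` always corresponds to the positive exponent/length `n + 1`.
-/

/-- `posPow a n` is the positive power `a ^ (n + 1)` of `a`. -/
def posPow {A : Type*} [NonUnitalRing A] (a : A) : ℕ → A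
  | 0 => a
  | n + 1 => posPow a n * a

/-- An element of a (possibly non-unital) ring is nilpotent if
some positive power of it is `0`. -/
def IsNilpotentElem {A : Type*} [NonUnitalRing A] (a : A) : Prop :=
  ∃ n : ℕ, posPow a n = 0

/-- `IsProdLen S n x` means that `x` is a product of `n + 1` elements of `S`
(multiplied in order, which suffices by associativity). -/
inductive IsProdLen {A : Type*} [NonUnitalRing A] (S : Set A) : ℕ → A → Prop
  | single {a : A} : a ∈ S → IsProdLen S 0 a
  | mul {a x : A} {n : ℕ} : a ∈ S → IsProdLen S n x → IsProdLen S (n + 1) (a * x)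

/-- The containment `J * K ⊆ I` of two-sided ideals, expressed elementwise
(this is equivalent, since `J * K` is the additive closure of the set of
products and `I` is closed under addition). -/
def ProdLE {A : Type*} [NonUnitalRing A] (J K I : TwoSidedIdeal A) : Prop :=
  ∀ x ∈ J, ∀ y ∈ K, x * y ∈ I

/-- `J * K = 0` for two-sided ideals `J`, `K`, expressed elementwise. -/
def ProdEqZero {A : Type*} [NonUnitalRing A] (J K : TwoSidedIdeal A) : Prop :=
  ∀ x ∈ J, ∀ y ∈ K, x * y = 0

/-- The containment `J ^ (m + 1) ⊆ I`, expressed elementwise. -/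
def PowLE {A : Type*} [NonUnitalRing A] (J : TwoSidedIdeal A) (m : ℕ)
    (I : TwoSidedIdeal A) : Prop :=
  ∀ x : A, IsProdLen (J : Set A) m x → x ∈ I

/-- `J ^ (m + 1) = 0`, expressed elementwise; so `∃ m, PowEqZero J m` says that
`J` is a nilpotent ideal. -/
def PowEqZero {A : Type*} [NonUnitalRing A] (J : TwoSidedIdeal A) (m : ℕ) : Prop :=
  ∀ x : A, IsProdLen (J : Set A) m x → x = 0

/-- `I` is a completely nilary ideal: whenever `a * b ∈ I`, some positive power of `a`
or some positive power of `b` lies in `I`. -/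
def IsCompletelyNilaryIdeal {A : Type*} [NonUnitalRing A] (I : TwoSidedIdeal A) : Prop :=
  ∀ a b : A, a * b ∈ I → (∃ n : ℕ, posPow a n ∈ I) ∨ (∃ m : ℕ, posPow b m ∈ I)

/-- `A` is a completely nilary ring: whenever `a * b = 0`, `a` is nilpotent or
`b` is nilpotent. -/
def IsCompletelyNilaryRing (A : Type*) [NonUnitalRing A] : Prop :=
  ∀ a b : A, a * b = 0 → IsNilpotentElem a ∨ IsNilpotentElem b

/-- `I` is a nilary ideal: whenever `J * K ⊆ I` for two-sided ideals `J`, `K`, some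
positive power of `J` or of `K` is contained in `I`. -/
def IsNilaryIdeal {A : Type*} [NonUnitalRing A] (I : TwoSidedIdeal A) : Prop :=
  ∀ J K : TwoSidedIdeal A, ProdLE J K I →
    (∃ m : ℕ, PowLE J m I) ∨ (∃ n : ℕ, PowLE K n I)

/-- `A` is a nilary ring: whenever `J * K = 0` for two-sided ideals `J`, `K`, then `J`
or `K` is nilpotent. -/
def IsNilaryRing (A : Type*) [NonUnitalRing A] : Prop :=
  ∀ J K : TwoSidedIdeal A, ProdEqZero J K →
    (∃ m : ℕ, PowEqZero J m) ∨ (∃ n : ℕ, PowEqZero K n)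

/-- `I` is a p-nilary ideal: the nilary condition for principal two-sided ideals. -/
def IsPNilaryIdeal {A : Type*} [NonUnitalRing A] (I : TwoSidedIdeal A) : Prop :=
  ∀ a b : A, ProdLE (TwoSidedIdeal.span {a}) (TwoSidedIdeal.span {b}) I →
    (∃ m : ℕ, PowLE (TwoSidedIdeal.span {a}) m I) ∨
    (∃ n : ℕ, PowLE (TwoSidedIdeal.span {b}) n I)

/-- `A` is a p-nilary ring: whenever `J * K = 0` for principal two-sided ideals `J`, `K`,
then `J` or `K` is nilpotent. -/
def IsPNilaryRing (A : Type*) [NonUnitalRing A] : Prop :=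
  ∀ a b : A, ProdEqZero (TwoSidedIdeal.span {a}) (TwoSidedIdeal.span {b}) →
    (∃ m : ℕ, PowEqZero (TwoSidedIdeal.span {a}) m) ∨
    (∃ n : ℕ, PowEqZero (TwoSidedIdeal.span {b}) n)

/-- `I` is a weakly nilary ideal: `I` is proper, and whenever `0 ≠ J * K ⊆ I` for two-sided
ideals `J`, `K`, some positive power of `J` or of `K` is contained in `I`. -/
def IsWeaklyNilaryIdeal {A : Type*} [NonUnitalRing A] (I : TwoSidedIdeal A) : Prop :=
  I ≠ ⊤ ∧ ∀ J K : TwoSidedIdeal A, ¬ ProdEqZero J K → ProdLE J K I →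
    (∃ m : ℕ, PowLE J m I) ∨ (∃ n : ℕ, PowLE K n I)

theorem mul_posPow {A : Type*} [NonUnitalRing A] (a : A) (n : ℕ) :
    a * posPow a n = posPow a (n + 1) := by
  induction n with
  | zero => rfl
  | succ n ih =>
    change a * (posPow a n * a) = posPow a (n + 1) * a
    rw [← mul_assoc, ih]

theorem posPow_mul_posPow {A : Type*} [NonUnitalRing A] (a : A) (m n : ℕ) :
    posPow a m * posPow a n = posPow a (m + n + 1) := by
  induction n with
  | zero => rfl
  | succ n ih =>
    change posPow a m * (posPow a n * a) = posPow a (m + n + 1) * a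
    rw [← mul_assoc, ih]

theorem exists_posPow_posPow_eq {A : Type*} [NonUnitalRing A] (a : A) (k n : ℕ) :
    ∃ m, posPow (posPow a k) n = posPow a m := by
  induction n with
  | zero => exact ⟨k, rfl⟩
  | succ n ih =>
    obtain ⟨m, hm⟩ := ih
    refine ⟨m + k + 1, ?_⟩
    change posPow (posPow a k) n * posPow a k = _
    rw [hm, posPow_mul_posPow]

theorem isProdLen_posPow {A : Type*} [NonUnitalRing A] {S : Set A} {a : A} (ha : a ∈ S)
    (n : ℕ) : IsProdLen S n (posPow a n) := by
  induction n with
  | zero => exact .single ha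
  | succ n ih =>
    rw [← mul_posPow]
    exact .mul ha ih

theorem IsProdLen.mem_twoSidedIdeal {A : Type*} [NonUnitalRing A] {Q : TwoSidedIdeal A}
    {n : ℕ} {x : A} (h : IsProdLen (Q : Set A) n x) : x ∈ Q := by
  cases h with
  | single h => exact h
  | mul h _ => exact Q.mul_mem_right _ _ h

theorem exists_posPow_mem_span_isProdLen {A : Type*} [NonUnitalRing A] {Q : TwoSidedIdeal A}
    {a : A} (n : ℕ) (h : ∃ k, posPow a k ∈ Q) :
    ∃ m, posPow a m ∈ TwoSidedIdeal.span {x : A | IsProdLen (Q : Set A) n x} := by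
  obtain ⟨k, hk⟩ := h
  obtain ⟨m, hm⟩ := exists_posPow_posPow_eq a k n
  exact ⟨m, TwoSidedIdeal.subset_span (hm ▸ isProdLen_posPow hk n)⟩

/-- If `Q` is a completely nilary two-sided ideal of `A`, then for every
positive integer `n + 1` the power `Q ^ (n + 1)` — which, since `Q` is a two-sided ideal,
coincides with the two-sided ideal generated by products of `n + 1` elements of `Q` — is a
completely nilary ideal of `A`. -/
theorem pow_isCompletelyNilary {A : Type*} [NonUnitalRing A] (Q : TwoSidedIdeal A)
    (hQ : IsCompletelyNilaryIdeal Q) (n : ℕ) :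
    IsCompletelyNilaryIdeal (TwoSidedIdeal.span {x : A | IsProdLen (Q : Set A) n x}) := by
  intro a b hab
  have hab' : a * b ∈ Q :=
    TwoSidedIdeal.span_le.2 (fun x hx => IsProdLen.mem_twoSidedIdeal hx) hab
  exact (hQ a b hab').imp (exists_posPow_mem_span_isProdLen n)
    (exists_posPow_mem_span_isProdLen n)
end

section
/- Let A be a ring with unity and L a proper two-sided ideal of A. Then the following are equivalent: (i) L is a weakly nilary ideal of A; (ii) for all right ideals I, J of A with 0 ≠ IJ ⊆ L, either Iⁿ ⊆ L or Jᵐ ⊆ L for some positive integers n, m; (iii) for all left ideals I, J of A with 0 ≠ IJ ⊆ L, either Iⁿ ⊆ L or Jᵐ ⊆ L for some positive integers n, m. -/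
/-- `S` is a right ideal of `A`: an additive subgroup absorbing multiplication on the
right by ring elements. -/
def IsRightIdeal {A : Type*} [Ring A] (S : Set A) : Prop :=
  (0 : A) ∈ S ∧ (∀ x ∈ S, ∀ y ∈ S, x + y ∈ S) ∧ (∀ x ∈ S, -x ∈ S) ∧
    ∀ x ∈ S, ∀ r : A, x * r ∈ S

/-- `S` is a left ideal of `A`: an additive subgroup absorbing multiplication on the
left by ring elements. -/
def IsLeftIdeal {A : Type*} [Ring A] (S : Set A) : Prop :=
  (0 : A) ∈ S ∧ (∀ x ∈ S, ∀ y ∈ S, x + y ∈ S) ∧ (∀ x ∈ S, -x ∈ S) ∧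
    ∀ x ∈ S, ∀ r : A, r * x ∈ S

/-- If `x * a * y ∈ L` for all `x ∈ S`, `a : A`, `y ∈ T`, then the product of the two-sided ideals
generated by `S` and `T` is contained in `L`. -/
theorem prodLE_span_span {A : Type*} [Ring A] {L : TwoSidedIdeal A} {S T : Set A}
    (h : ∀ x ∈ S, ∀ a : A, ∀ y ∈ T, x * a * y ∈ L) :
    ProdLE (TwoSidedIdeal.span S) (TwoSidedIdeal.span T) L := by
  intro x hx y hy
  have hxT : ∀ a : A, ∀ z ∈ T, x * a * z ∈ L := by
    induction hx using TwoSidedIdeal.span_induction with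
    | mem x hx => exact h x hx
    | zero => simp [L.zero_mem]
    | add x y _ _ ihx ihy =>
      intro a z hz
      simpa only [add_mul] using L.add_mem (ihx a z hz) (ihy a z hz)
    | neg x _ ih =>
      intro a z hz
      simpa only [neg_mul] using L.neg_mem (ih a z hz)
    | left_absorb b x _ ih =>
      intro a z hz
      simpa only [mul_assoc] using L.mul_mem_left b _ (ih a z hz)
    | right_absorb b x _ ih =>
      intro a z hz
      simpa only [mul_assoc] using ih (b * a) z hz
  have hxy : ∀ a : A, x * a * y ∈ L := by
    induction hy using TwoSidedIdeal.span_induction with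
    | mem y hy => exact fun a => hxT a y hy
    | zero => simp [L.zero_mem]
    | add y z _ _ ihy ihz =>
      intro a
      simpa only [mul_add] using L.add_mem (ihy a) (ihz a)
    | neg y _ ih =>
      intro a
      simpa only [mul_neg] using L.neg_mem (ih a)
    | left_absorb b y _ ih =>
      intro a
      simpa only [mul_assoc] using ih (a * b)
    | right_absorb b y _ ih =>
      intro a
      simpa only [mul_assoc] using L.mul_mem_right _ b (ih a)
  simpa using hxy 1

theorem IsProdLen.mono {A : Type*} [NonUnitalRing A] {S T : Set A} (h : S ⊆ T) {n : ℕ} {x : A}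
    (hx : IsProdLen S n x) : IsProdLen T n x := by
  induction hx with
  | single ha => exact .single (h ha)
  | mul ha _ ih => exact .mul (h ha) ih

/-- The weakly nilary condition extends to arbitrary subsets `S`, `T` with `S * A * T ⊆ L` and
`S * T ≠ 0`. -/
theorem IsWeaklyNilaryIdeal.exists_isProdLen_imp_mem {A : Type*} [Ring A] {L : TwoSidedIdeal A}
    (hL : IsWeaklyNilaryIdeal L) {S T : Set A} (h0 : ∃ x ∈ S, ∃ y ∈ T, x * y ≠ 0)
    (h : ∀ x ∈ S, ∀ a : A, ∀ y ∈ T, x * a * y ∈ L) :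
    (∃ n : ℕ, ∀ x : A, IsProdLen S n x → x ∈ L) ∨
      (∃ m : ℕ, ∀ y : A, IsProdLen T m y → y ∈ L) := by
  obtain ⟨x, hx, y, hy, hxy⟩ := h0
  have hne : ¬ ProdEqZero (TwoSidedIdeal.span S) (TwoSidedIdeal.span T) := fun hz =>
    hxy (hz x (TwoSidedIdeal.subset_span hx) y (TwoSidedIdeal.subset_span hy))
  exact (hL.2 _ _ hne (prodLE_span_span h)).imp
    (fun ⟨n, hn⟩ => ⟨n, fun z hz => hn z (hz.mono TwoSidedIdeal.subset_span)⟩)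
    (fun ⟨m, hm⟩ => ⟨m, fun z hz => hm z (hz.mono TwoSidedIdeal.subset_span)⟩)

theorem TwoSidedIdeal.isRightIdeal {A : Type*} [Ring A] (J : TwoSidedIdeal A) :
    IsRightIdeal (J : Set A) :=
  ⟨J.zero_mem, fun _ hx _ hy => J.add_mem hx hy, fun _ hx => J.neg_mem hx,
    fun _ hx r => J.mul_mem_right _ r hx⟩

theorem TwoSidedIdeal.isLeftIdeal {A : Type*} [Ring A] (J : TwoSidedIdeal A) :
    IsLeftIdeal (J : Set A) :=
  ⟨J.zero_mem, fun _ hx _ hy => J.add_mem hx hy, fun _ hx => J.neg_mem hx,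
    fun _ hx r => J.mul_mem_left r _ hx⟩

theorem exists_mul_ne_zero_of_not_prodEqZero {A : Type*} [NonUnitalRing A] {J K : TwoSidedIdeal A}
    (h : ¬ ProdEqZero J K) : ∃ x ∈ (J : Set A), ∃ y ∈ (K : Set A), x * y ≠ 0 := by
  by_contra! hz
  exact h hz

/-- For a ring `A` with unity and a proper two-sided ideal `L`, the
following are equivalent:
(i) `L` is a weakly nilary ideal;
(ii) for all right ideals `I, J` with `0 ≠ I * J ⊆ L`, some positive power of `I` or of
`J` is contained in `L`;
(iii) the same with left ideals.
All products/powers of one-sided ideals are expressed elementwise, which is equivalent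
since `L` is closed under addition. -/
theorem weaklyNilary_iff_right_iff_left
    {A : Type*} [Ring A] (L : TwoSidedIdeal A) (hL : L ≠ ⊤) :
    (IsWeaklyNilaryIdeal L ↔
      (∀ I J : Set A, IsRightIdeal I → IsRightIdeal J →
        (∃ x ∈ I, ∃ y ∈ J, x * y ≠ 0) → (∀ x ∈ I, ∀ y ∈ J, x * y ∈ L) →
        (∃ n : ℕ, ∀ x : A, IsProdLen I n x → x ∈ L) ∨
        (∃ m : ℕ, ∀ y : A, IsProdLen J m y → y ∈ L))) ∧
    (IsWeaklyNilaryIdeal L ↔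
      (∀ I J : Set A, IsLeftIdeal I → IsLeftIdeal J →
        (∃ x ∈ I, ∃ y ∈ J, x * y ≠ 0) → (∀ x ∈ I, ∀ y ∈ J, x * y ∈ L) →
        (∃ n : ℕ, ∀ x : A, IsProdLen I n x → x ∈ L) ∨
        (∃ m : ℕ, ∀ y : A, IsProdLen J m y → y ∈ L))) := by
  refine ⟨⟨fun h I J hI _ h0 hIJ => ?_, fun h => ⟨hL, fun J K h0 hJK => ?_⟩⟩,
    ⟨fun h I J _ hJ h0 hIJ => ?_, fun h => ⟨hL, fun J K h0 hJK => ?_⟩⟩⟩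
  · exact h.exists_isProdLen_imp_mem h0 fun x hx a y hy => hIJ _ (hI.2.2.2 x hx a) y hy
  · exact h J K J.isRightIdeal K.isRightIdeal (exists_mul_ne_zero_of_not_prodEqZero h0) hJK
  · refine h.exists_isProdLen_imp_mem h0 fun x hx a y hy => ?_
    rw [mul_assoc]
    exact hIJ x hx _ (hJ.2.2.2 y hy a)
  · exact h J K J.isLeftIdeal K.isLeftIdeal (exists_mul_ne_zero_of_not_prodEqZero h0) hJK
end
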